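/- Consider problem (P2): minimize J[x] = ∫₀¹ f(x(t), t) dt + q(x(1)) over arcs x : [0,1] → ℝⁿ that are differentiable with integrable derivative and satisfy W²_k(x(t), x'(t)) ≤ 0 for a.e. t ∈ [0,1] (k = 1, …, m) and x(0) = v₀, where each f(·, t) : ℝⁿ → ℝ is convex and differentiable with t ↦ f(x(t), t) integrable along feasible arcs, each W²_k : ℝⁿ × ℝⁿ → ℝ is convex, and q : ℝⁿ → ℝ is convex. Let x̃ be a feasible arc and suppose there exist a differentiable u* : [0,1] → ℝⁿ with integrable derivative and measurable functions α_k : [0,1] → [0,∞) such that for almost every t ∈ [0,1]: (d) there exist subgradients s_k(t) ∈ ∂W²_k(x̃(t), x̃'(t)) with (u*'(t) − ∇f(x̃(t), t), u*(t)) = ∑_{k=1}^m α_k(t) s_k(t); (e) −u*(1) is a subgradient of q at x̃(1); and (f) α_k(t) · W²_k(x̃(t), x̃'(t)) = 0 for every k. Then x̃ is optimal: J[x] ≥ J[x̃] for every feasible arc x. -/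

import Mathlib

open scoped RealInnerProductSpace
open Set MeasureTheory

noncomputable section

abbrev E (n : ℕ) := EuclideanSpace ℝ (Fin n)

/-- The product inner product on `ℝⁿ × ℝⁿ × ℝⁿ`. -/
def inner3 {n : ℕ} (a b : E n × E n × E n) : ℝ :=
  ⟪a.1, b.1⟫ + ⟪a.2.1, b.2.1⟫ + ⟪a.2.2, b.2.2⟫

/-- `s` is a subgradient of `g : ℝⁿ × ℝⁿ × ℝⁿ → ℝ` at `x`. -/
def IsSubgrad3 {n : ℕ} (g : E n × E n × E n → ℝ) (x s : E n × E n × E n) : Prop :=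
  ∀ y, g y - g x ≥ inner3 s (y - x)

/-- The product inner product on `ℝⁿ × ℝⁿ`. -/
def inner2 {n : ℕ} (a b : E n × E n) : ℝ :=
  ⟪a.1, b.1⟫ + ⟪a.2, b.2⟫

/-- `s` is a subgradient of `g : ℝⁿ × ℝⁿ → ℝ` at `x`. -/
def IsSubgrad2 {n : ℕ} (g : E n × E n → ℝ) (x s : E n × E n) : Prop :=
  ∀ y, g y - g x ≥ inner2 s (y - x)

/-- `s` is a subgradient of `g : ℝⁿ → ℝ` at `x`. -/
def IsSubgrad1 {n : ℕ} (g : E n → ℝ) (x s : E n) : Prop :=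
  ∀ y, g y - g x ≥ ⟪s, y - x⟫

/-- Feasible arcs for problem (P2): `x` differentiable on `[0,1]` with
integrable derivative, satisfying `W²_k(x(t), x'(t)) ≤ 0` a.e. and `x(0) = v₀`. -/
def FeasibleP2 (n m : ℕ) (W2 : Fin m → E n × E n → ℝ) (v0 : E n)
    (x x' : ℝ → E n) : Prop :=
  (∀ t ∈ Icc (0 : ℝ) 1, HasDerivWithinAt x (x' t) (Icc 0 1) t) ∧
  IntegrableOn x' (Icc (0 : ℝ) 1) ∧
  (∀ᵐ t : ℝ ∂volume, t ∈ Icc (0 : ℝ) 1 → ∀ k, W2 k (x t, x' t) ≤ 0) ∧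
  x 0 = v0

/-- The Bolza cost functional. -/
def J (n : ℕ) (f : ℝ → E n → ℝ) (q : E n → ℝ) (x : ℝ → E n) : ℝ :=
  (∫ t in (0 : ℝ)..1, f t (x t)) + q (x 1)

section Auxiliary

variable {F : Type*} [NormedAddCommGroup F] [InnerProductSpace ℝ F]

/-- A differentiable convex function lies above its tangent planes. -/
theorem ConvexOn.inner_gradient_le_sub [CompleteSpace F] {g : F → ℝ} (hg : ConvexOn ℝ univ g)
    {x : F} (hd : DifferentiableAt ℝ g x) (y : F) :
    ⟪gradient g x, y - x⟫ ≤ g y - g x := by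
  have hconv : ConvexOn ℝ univ (g ∘ AffineMap.lineMap (k := ℝ) x y) := by
    simpa using hg.comp_affineMap (AffineMap.lineMap (k := ℝ) x y)
  have hderiv : HasDerivAt (g ∘ AffineMap.lineMap (k := ℝ) x y)
      ⟪gradient g x, y - x⟫ (0 : ℝ) := by
    have hx := hd.hasGradientAt.hasFDerivAt
    rw [← AffineMap.lineMap_apply_zero (k := ℝ) x y] at hx
    simpa using hx.comp_hasDerivAt (0 : ℝ) AffineMap.hasDerivAt_lineMap
  simpa [slope_def_field] using
    hconv.le_slope_of_hasDerivAt (mem_univ 0) (mem_univ 1) one_pos hderiv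

theorem ContinuousOn.integrableOn_inner {u v : ℝ → F} {K : Set ℝ} (hK : IsCompact K)
    (hu : ContinuousOn u K) (hv : IntegrableOn v K) :
    IntegrableOn (fun t => ⟪u t, v t⟫) K := by
  obtain ⟨C, hC⟩ := hK.exists_bound_of_continuousOn hu
  refine Integrable.mono' (hv.norm.const_mul C)
    ((hu.aestronglyMeasurable_of_isCompact hK hK.measurableSet).inner hv.1) ?_
  filter_upwards [ae_restrict_mem hK.measurableSet] with t ht
  exact (norm_inner_le_norm _ _).trans
    (mul_le_mul_of_nonneg_right (hC t ht) (norm_nonneg _))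

theorem intervalIntegrable_inner_add_inner {a b : ℝ} (hab : a ≤ b) {u u' v v' : ℝ → F}
    (hu : ContinuousOn u (Icc a b)) (hv : ContinuousOn v (Icc a b))
    (hu' : IntegrableOn u' (Icc a b)) (hv' : IntegrableOn v' (Icc a b)) :
    IntervalIntegrable (fun t => ⟪u t, v' t⟫ + ⟪u' t, v t⟫) volume a b := by
  rw [intervalIntegrable_iff_integrableOn_Icc_of_le hab]
  refine (hu.integrableOn_inner isCompact_Icc hv').add ?_
  simpa only [real_inner_comm] using hv.integrableOn_inner isCompact_Icc hu'

/-- Integration by parts for the inner product of two arcs. -/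
theorem integral_inner_add_inner_eq_sub {a b : ℝ} (hab : a ≤ b) {u u' v v' : ℝ → F}
    (hu : ∀ t ∈ Icc a b, HasDerivWithinAt u (u' t) (Icc a b) t)
    (hv : ∀ t ∈ Icc a b, HasDerivWithinAt v (v' t) (Icc a b) t)
    (hu' : IntegrableOn u' (Icc a b)) (hv' : IntegrableOn v' (Icc a b)) :
    ∫ t in a..b, (⟪u t, v' t⟫ + ⟪u' t, v t⟫) = ⟪u b, v b⟫ - ⟪u a, v a⟫ := by
  have hcu : ContinuousOn u (Icc a b) := fun t ht => (hu t ht).continuousWithinAt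
  have hcv : ContinuousOn v (Icc a b) := fun t ht => (hv t ht).continuousWithinAt
  refine intervalIntegral.integral_eq_sub_of_hasDerivAt_of_le hab (hcu.inner hcv) ?_
    (intervalIntegrable_inner_add_inner hab hcu hcv hu' hv')
  intro t ht
  have hnhds := Icc_mem_nhds ht.1 ht.2
  have ht' := Ioo_subset_Icc_self ht
  exact ((hu t ht').hasDerivAt hnhds).inner ℝ ((hv t ht').hasDerivAt hnhds)

end Auxiliary

theorem inner2_sum_smul {n : ℕ} {ι : Type*} (S : Finset ι) (c : ι → ℝ) (s : ι → E n × E n)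
    (d : E n × E n) :
    inner2 (∑ k ∈ S, c k • s k) d = ∑ k ∈ S, c k * inner2 (s k) d := by
  simp only [inner2, Prod.fst_sum, Prod.snd_sum, sum_inner, Prod.smul_fst, Prod.smul_snd,
    real_inner_smul_left, mul_add, Finset.sum_add_distrib]

/-- Under complementary slackness, a nonnegative combination of subgradients of constraint
functions has nonpositive inner product with every feasible displacement. -/
theorem inner2_sum_smul_subgrad_nonpos {n : ℕ} {ι : Type*} (S : Finset ι)
    {W : ι → E n × E n → ℝ} {c : ι → ℝ} {s : ι → E n × E n} {z y : E n × E n}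
    (hc : ∀ k, 0 ≤ c k) (hs : ∀ k, IsSubgrad2 (W k) z (s k))
    (hslack : ∀ k, c k * W k z = 0) (hy : ∀ k, W k y ≤ 0) :
    inner2 (∑ k ∈ S, c k • s k) (y - z) ≤ 0 := by
  rw [inner2_sum_smul]
  refine Finset.sum_nonpos fun k _ => ?_
  have h₁ := mul_le_mul_of_nonneg_left (hs k y) (hc k)
  have h₂ := mul_nonpos_of_nonneg_of_nonpos (hc k) (hy k)
  linarith [hslack k, mul_sub (c k) (W k y) (W k z)]

theorem stmt12 (n m : ℕ) (v0 : E n)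
    (f : ℝ → E n → ℝ) (q : E n → ℝ)
    (W2 : Fin m → E n × E n → ℝ)
    (hfconv : ∀ t, ConvexOn ℝ univ (f t))
    (hfdiff : ∀ t, Differentiable ℝ (f t))
    (hfint : ∀ x x' : ℝ → E n, FeasibleP2 n m W2 v0 x x' →
      IntervalIntegrable (fun t => f t (x t)) volume 0 1)
    (hWconv : ∀ k, ConvexOn ℝ univ (W2 k))
    (hqconv : ConvexOn ℝ univ q)
    (xtil xtil' : ℝ → E n)
    (hfeas : FeasibleP2 n m W2 v0 xtil xtil')
    (us us' : ℝ → E n)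
    (hus : ∀ t ∈ Icc (0 : ℝ) 1, HasDerivWithinAt us (us' t) (Icc 0 1) t)
    (husint : IntegrableOn us' (Icc (0 : ℝ) 1))
    (α : Fin m → ℝ → ℝ)
    (hαmeas : ∀ k, Measurable (α k))
    (hαpos : ∀ k, ∀ t ∈ Icc (0 : ℝ) 1, 0 ≤ α k t)
    -- (d) the adjoint inclusion and (f) complementary slackness a.e.
    (hadj : ∀ᵐ t : ℝ ∂volume, t ∈ Icc (0 : ℝ) 1 →
      (∃ sk : Fin m → E n × E n,
        (∀ k, IsSubgrad2 (W2 k) (xtil t, xtil' t) (sk k)) ∧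
        (us' t - gradient (f t) (xtil t), us t) = ∑ k, α k t • sk k) ∧
      (∀ k, α k t * W2 k (xtil t, xtil' t) = 0))
    -- (e) transversality condition
    (htrans : IsSubgrad1 q (xtil 1) (-us 1)) :
    ∀ x x' : ℝ → E n, FeasibleP2 n m W2 v0 x x' →
      J n f q x ≥ J n f q xtil := by
  intro x x' hx
  obtain ⟨hxd, hxint, hxW, hx0⟩ := id hx
  obtain ⟨hzd, hzint, -, hz0⟩ := id hfeas
  have hdd : ∀ t ∈ Icc (0 : ℝ) 1,
      HasDerivWithinAt (fun t => x t - xtil t) (x' t - xtil' t) (Icc 0 1) t :=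
    fun t ht => (hxd t ht).sub (hzd t ht)
  have hdint : IntegrableOn (fun t => x' t - xtil' t) (Icc (0 : ℝ) 1) := hxint.sub hzint
  have hparts := integral_inner_add_inner_eq_sub zero_le_one hus hdd husint hdint
  have hpint := intervalIntegrable_inner_add_inner zero_le_one
    (fun t ht => (hus t ht).continuousWithinAt) (fun t ht => (hdd t ht).continuousWithinAt)
    husint hdint
  have hfx := hfint x x' hx
  have hfz := hfint xtil xtil' hfeas
  have hmono : ∫ t in (0 : ℝ)..1, (⟪us t, x' t - xtil' t⟫ + ⟪us' t, x t - xtil t⟫)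
      ≤ ∫ t in (0 : ℝ)..1, (f t (x t) - f t (xtil t)) := by
    refine intervalIntegral.integral_mono_ae_restrict zero_le_one hpint (hfx.sub hfz) ?_
    filter_upwards [ae_restrict_mem measurableSet_Icc, ae_restrict_of_ae hxW,
      ae_restrict_of_ae hadj] with t ht hW hadj_t
    obtain ⟨⟨sk, hsub, hsum⟩, hslack⟩ := hadj_t ht
    have hgrad := (hfconv t).inner_gradient_le_sub (hfdiff t (xtil t)) (x t)
    have hcone := inner2_sum_smul_subgrad_nonpos Finset.univ (fun k => hαpos k t ht) hsub
      hslack (hW ht)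
    rw [← hsum] at hcone
    simp only [inner2, Prod.fst_sub, Prod.snd_sub, inner_sub_left _ _ (x t - xtil t)] at hcone
    linarith
  rw [hparts, intervalIntegral.integral_sub hfx hfz, hx0, hz0, sub_self, inner_zero_right,
    sub_zero] at hmono
  have hend := htrans (x 1)
  rw [inner_neg_left] at hend
  simp only [J]
  linarith
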